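/- arXiv:1412.8598 — 7 statements merged into one kernel-verified Lean document; each statement's English description precedes it below -/
import Mathlib

section
/- If A ∈ M and A x ≠ 0, then ω(A*A) = ⟪A* A x, x⟫ > 0 and the operator ω(A*A)⁻¹ • (A ∘ E ∘ A*) is a rank-one orthogonal projection belonging to 𝒞 which fixes the vector A x. -/
open scoped InnerProductSpace ComplexOrder
open ContinuousLinearMap

/-- If `E` is the map `y ↦ ⟪x, y⟫ • x`, then `A ∘ E ∘ A*`, divided by `‖A x‖ ^ 2`, is the
orthogonal projection onto the line spanned by `A x`. -/
theorem inv_smul_comp_adjoint_eq_starProjection {H : Type*} [NormedAddCommGroup H]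
    [InnerProductSpace ℂ H] [CompleteSpace H] {x : H} {E : H →L[ℂ] H}
    (hE : ∀ y : H, E y = ⟪x, y⟫_ℂ • x) (A : H →L[ℂ] H) :
    ((‖A x‖ : ℂ) ^ 2)⁻¹ • (A ∘L E ∘L ContinuousLinearMap.adjoint A) =
      (ℂ ∙ A x).starProjection := by
  ext y
  simp [Submodule.starProjection_singleton, hE, adjoint_inner_right, smul_smul, div_eq_inv_mul]

/-- if `A ∈ M` and `A x ≠ 0`, then `ω(A*A) = ⟪A*A x, x⟫ > 0` and
`ω(A*A)⁻¹ • (A ∘ E ∘ A*)` is a rank-one orthogonal projection in `𝒞` fixing `A x`. -/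
theorem stmt1 {H : Type*} [NormedAddCommGroup H] [InnerProductSpace ℂ H] [CompleteSpace H]
    (M : VonNeumannAlgebra H)
    (hfactor : ∀ T ∈ M, T ∈ M.commutant → ∃ c : ℂ, T = c • (1 : H →L[ℂ] H))
    (x : H) (hx : ‖x‖ = 1)
    (hcyclic : closure {y : H | ∃ A ∈ M, y = A x} = Set.univ)
    (hseparating : ∀ A ∈ M, A x = 0 → A = 0)
    (E : H →L[ℂ] H) (hE : ∀ y : H, E y = ⟪x, y⟫_ℂ • x)
    (𝒞 : Submodule ℂ (H →L[ℂ] H))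
    (h𝒞 : 𝒞 = Submodule.span ℂ {T : H →L[ℂ] H | ∃ A ∈ M, ∃ B ∈ M, T = A ∘L E ∘L B})
    (A : H →L[ℂ] H) (hA : A ∈ M) (hAx : A x ≠ 0) :
    0 < (⟪(ContinuousLinearMap.adjoint A ∘L A) x, x⟫_ℂ) ∧
    (let P : H →L[ℂ] H :=
      (⟪(ContinuousLinearMap.adjoint A ∘L A) x, x⟫_ℂ)⁻¹ •
        (A ∘L E ∘L ContinuousLinearMap.adjoint A)
     IsSelfAdjoint P ∧ P ∘L P = P ∧
       Module.finrank ℂ (LinearMap.range (P : H →ₗ[ℂ] H)) = 1 ∧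
       P ∈ 𝒞 ∧ P (A x) = A x) := by
  have hω : ⟪(ContinuousLinearMap.adjoint A ∘L A) x, x⟫_ℂ = (‖A x‖ : ℂ) ^ 2 := by
    rw [comp_apply, adjoint_inner_left, inner_self_eq_norm_sq_to_K]
    rfl
  have hAstar : ContinuousLinearMap.adjoint A ∈ M := by
    simpa only [star_eq_adjoint] using star_mem hA
  have hmem : A ∘L E ∘L ContinuousLinearMap.adjoint A ∈ 𝒞 :=
    h𝒞 ▸ Submodule.subset_span ⟨A, hA, _, hAstar, rfl⟩
  rw [hω]
  refine ⟨by exact_mod_cast pow_pos (norm_pos_iff.mpr hAx) 2, ?_⟩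
  intro P
  have hP : P = (ℂ ∙ A x).starProjection := inv_smul_comp_adjoint_eq_starProjection hE A
  refine ⟨hP ▸ isSelfAdjoint_starProjection _, ?_, ?_, 𝒞.smul_mem _ hmem, ?_⟩
  · rw [hP]
    exact (ℂ ∙ A x).isIdempotentElem_starProjection
  · rw [hP, Submodule.range_starProjection, finrank_span_singleton hAx]
  · rw [hP, Submodule.starProjection_eq_self_iff]
    exact Submodule.mem_span_singleton_self _
end

section
/- If P ∈ 𝒞 is a nonzero orthogonal projection (P* = P, P ∘ P = P, P ≠ 0), then there exists a rank-one orthogonal projection F ∈ 𝒞 with F ≤ P (i.e., P ∘ F = F). -/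
open scoped InnerProductSpace
open ContinuousLinearMap

/-- Every operator in the span of `{A ∘ E ∘ B : A, B ∈ M}`, with `E` the projection onto `ℂ • x`,
maps into the orbit of `x` under `M`. -/
theorem exists_mem_apply_eq_of_mem_span {H : Type*} [NormedAddCommGroup H]
    [InnerProductSpace ℂ H] [CompleteSpace H] (M : VonNeumannAlgebra H) (x : H) (E : H →L[ℂ] H)
    (hE : ∀ y : H, E y = ⟪x, y⟫_ℂ • x) {T : H →L[ℂ] H}
    (hT : T ∈ Submodule.span ℂ {T : H →L[ℂ] H | ∃ A ∈ M, ∃ B ∈ M, T = A ∘L E ∘L B}) (y : H) :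
    ∃ A ∈ M, T y = A x := by
  induction hT using Submodule.span_induction with
  | mem T hT =>
    obtain ⟨A, hA, B, -, rfl⟩ := hT
    exact ⟨⟪x, B y⟫_ℂ • A, M.toStarSubalgebra.smul_mem hA _, by simp [hE]⟩
  | zero => exact ⟨0, zero_mem M.toStarSubalgebra, by simp⟩
  | add S T _ _ hS hT =>
    obtain ⟨A, hA, hSA⟩ := hS
    obtain ⟨B, hB, hTB⟩ := hT
    exact ⟨A + B, add_mem (S := StarSubalgebra ℂ _) (s := M.toStarSubalgebra) hA hB,
      by simp [hSA, hTB]⟩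
  | smul c T _ hT =>
    obtain ⟨A, hA, hTA⟩ := hT
    exact ⟨c • A, M.toStarSubalgebra.smul_mem hA c, by simp [hTA]⟩

/-- every nonzero orthogonal projection in `𝒞` majorizes a rank-one
orthogonal projection belonging to `𝒞`. -/
theorem stmt2 {H : Type*} [NormedAddCommGroup H] [InnerProductSpace ℂ H] [CompleteSpace H]
    (M : VonNeumannAlgebra H)
    (hfactor : ∀ T ∈ M, T ∈ M.commutant → ∃ c : ℂ, T = c • (1 : H →L[ℂ] H))
    (x : H) (hx : ‖x‖ = 1)
    (hcyclic : closure {y : H | ∃ A ∈ M, y = A x} = Set.univ)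
    (hseparating : ∀ A ∈ M, A x = 0 → A = 0)
    (E : H →L[ℂ] H) (hE : ∀ y : H, E y = ⟪x, y⟫_ℂ • x)
    (𝒞 : Submodule ℂ (H →L[ℂ] H))
    (h𝒞 : 𝒞 = Submodule.span ℂ {T : H →L[ℂ] H | ∃ A ∈ M, ∃ B ∈ M, T = A ∘L E ∘L B})
    (P : H →L[ℂ] H) (hP𝒞 : P ∈ 𝒞) (hPsa : IsSelfAdjoint P) (hPidem : P ∘L P = P)
    (hPne : P ≠ 0) :
    ∃ F : H →L[ℂ] H, F ∈ 𝒞 ∧ IsSelfAdjoint F ∧ F ∘L F = F ∧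
      Module.finrank ℂ (LinearMap.range (F : H →ₗ[ℂ] H)) = 1 ∧ P ∘L F = F := by
  subst h𝒞
  obtain ⟨y, hy⟩ : ∃ y, P y ≠ 0 := by
    by_contra! h
    exact hPne (ContinuousLinearMap.ext h)
  obtain ⟨A₀, hA₀, hPy⟩ := exists_mem_apply_eq_of_mem_span M x E hE hP𝒞 y
  set A : H →L[ℂ] H := (‖P y‖⁻¹ : ℂ) • A₀ with hAdef
  have hA : A ∈ M := M.toStarSubalgebra.smul_mem hA₀ _
  have hAx : A x = (‖P y‖⁻¹ : ℂ) • P y := by rw [hPy]; simp [hAdef, hPy]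
  have hnorm : ‖A x‖ = 1 := by rw [hAx]; exact norm_smul_inv_norm hy
  have hPA : P (A x) = A x := by
    rw [hAx, map_smul, ← ContinuousLinearMap.comp_apply, hPidem]
  have hF (z : H) : (A ∘L E ∘L adjoint A) z = ⟪A x, z⟫_ℂ • A x := by
    simp [hE, adjoint_inner_right]
  have hinner : ⟪A x, A x⟫_ℂ = 1 := by simp [inner_self_eq_norm_sq_to_K, hnorm]
  refine ⟨A ∘L E ∘L adjoint A, Submodule.subset_span ⟨A, hA, adjoint A, ?_, rfl⟩, ?_, ?_, ?_, ?_⟩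
  · exact star_mem (s := M.toStarSubalgebra) hA
  · rw [isSelfAdjoint_iff_isSymmetric]
    intro v w
    simp only [coe_coe, hF, inner_smul_left, inner_smul_right, inner_conj_symm]
    ring
  · ext z
    rw [ContinuousLinearMap.comp_apply, hF z, map_smul, hF, hinner, one_smul]
  · have hrange : LinearMap.range ((A ∘L E ∘L adjoint A : H →L[ℂ] H) : H →ₗ[ℂ] H) =
        Submodule.span ℂ {A x} := by
      apply le_antisymm
      · rintro _ ⟨z, rfl⟩
        rw [coe_coe, hF]
        exact Submodule.smul_mem _ _ (Submodule.mem_span_singleton_self _)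
      · rw [Submodule.span_singleton_le_iff_mem]
        exact ⟨A x, by rw [coe_coe, hF, hinner, one_smul]⟩
    rw [hrange]
    exact finrank_span_singleton (norm_ne_zero_iff.mp (by simp [hnorm]))
  · ext z
    rw [ContinuousLinearMap.comp_apply, hF, map_smul, hPA]
end

section
/- Let T ∈ 𝒞 be self-adjoint. Then there exist a finite index set J, operators S_j ∈ M and real numbers c_j (j ∈ J) such that each S_j ∘ E ∘ S_j* is a rank-one orthogonal projection, these projections are mutually orthogonal ((S_j ∘ E ∘ S_j*) ∘ (S_k ∘ E ∘ S_k*) = 0 for j ≠ k), and T = Σ_{j ∈ J} c_j • (S_j ∘ E ∘ S_j*). -/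
open scoped InnerProductSpace
open ContinuousLinearMap

/-- A self-adjoint operator mapping into a finite-dimensional subspace `V` is diagonalised by an
orthonormal family in `V`. -/
theorem exists_orthonormal_eq_sum_of_isSelfAdjoint {H : Type*} [NormedAddCommGroup H]
    [InnerProductSpace ℂ H] [CompleteSpace H] (T : H →L[ℂ] H) (hT : IsSelfAdjoint T)
    (V : Submodule ℂ H) [FiniteDimensional ℂ V] (hV : ∀ y, T y ∈ V) :
    ∃ (n : ℕ) (e : Fin n → H) (c : Fin n → ℝ), Orthonormal ℂ e ∧ (∀ j, e j ∈ V) ∧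
      ∀ y, T y = ∑ j, (c j : ℂ) • ⟪e j, y⟫_ℂ • e j := by
  have hsymm : (T : H →ₗ[ℂ] H).IsSymmetric := hT.isSymmetric
  have hR : ((T : H →ₗ[ℂ] H).restrict fun y (_ : y ∈ V) => hV y).IsSymmetric :=
    hsymm.restrict_invariant _
  let b := hR.eigenvectorBasis rfl
  refine ⟨_, fun j => (b j : H), hR.eigenvalues rfl, ?_, fun j => (b j).2, fun y => ?_⟩
  · exact b.orthonormal.comp_linearIsometry V.subtypeₗᵢ
  have heig (j) : T (b j : H) = (hR.eigenvalues rfl j : ℂ) • (b j : H) :=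
    congrArg Subtype.val (hR.apply_eigenvectorBasis rfl j)
  have hsum := congrArg Subtype.val (b.sum_repr' ⟨T y, hV y⟩)
  simp only [AddSubmonoidClass.coe_finsetSum, Submodule.coe_smul, Submodule.coe_inner] at hsum
  rw [← hsum]
  refine Finset.sum_congr rfl fun j _ => ?_
  have hinner : ⟪(b j : H), T y⟫_ℂ = ⟪T (b j : H), y⟫_ℂ := (hsymm _ _).symm
  rw [hinner, heig, inner_smul_left, Complex.conj_ofReal, mul_smul]

/-- Elements of the span of the operators `A ∘ E ∘ B`, where `E y = ⟪x, y⟫ • x` and `A`, `B` range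
over `M`, map into a finite-dimensional subspace of the orbit `M x`. -/
theorem exists_finiteDimensional_range_le {H : Type*} [NormedAddCommGroup H]
    [InnerProductSpace ℂ H] (M : Submodule ℂ (H →L[ℂ] H)) (x : H)
    (E : H →L[ℂ] H) (hE : ∀ y : H, E y = ⟪x, y⟫_ℂ • x) (T : H →L[ℂ] H)
    (hT : T ∈ Submodule.span ℂ {T : H →L[ℂ] H | ∃ A ∈ M, ∃ B ∈ M, T = A ∘L E ∘L B}) :
    ∃ V : Submodule ℂ H, FiniteDimensional ℂ V ∧ (∀ v ∈ V, ∃ A ∈ M, A x = v) ∧ ∀ y, T y ∈ V := by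
  induction hT using Submodule.span_induction with
  | mem T h =>
    obtain ⟨A, hA, B, -, rfl⟩ := h
    refine ⟨ℂ ∙ A x, inferInstance, fun v hv => ?_, fun y => ?_⟩
    · obtain ⟨a, rfl⟩ := Submodule.mem_span_singleton.1 hv
      exact ⟨a • A, M.smul_mem a hA, rfl⟩
    · simpa [hE] using Submodule.smul_mem _ _ (Submodule.mem_span_singleton_self (A x))
  | zero => exact ⟨⊥, inferInstance, fun v hv => ⟨0, M.zero_mem, by simp_all⟩, fun y => by simp⟩
  | add T₁ T₂ _ _ h₁ h₂ =>
    obtain ⟨V₁, _, horb₁, hV₁⟩ := h₁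
    obtain ⟨V₂, _, horb₂, hV₂⟩ := h₂
    refine ⟨V₁ ⊔ V₂, inferInstance, fun v hv => ?_, fun y =>
      Submodule.add_mem_sup (hV₁ y) (hV₂ y)⟩
    obtain ⟨v₁, hv₁, v₂, hv₂, rfl⟩ := Submodule.mem_sup.1 hv
    obtain ⟨A₁, hA₁, rfl⟩ := horb₁ v₁ hv₁
    obtain ⟨A₂, hA₂, rfl⟩ := horb₂ v₂ hv₂
    exact ⟨A₁ + A₂, M.add_mem hA₁ hA₂, rfl⟩
  | smul a T _ h =>
    obtain ⟨V, hfin, horb, hV⟩ := h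
    exact ⟨V, hfin, horb, fun y => V.smul_mem a (hV y)⟩

/-- spectral theorem for self-adjoint `T ∈ 𝒞`: `T` is a real linear
combination of mutually orthogonal rank-one projections of the form `S_j ∘ E ∘ S_j*`
with `S_j ∈ M`. -/
theorem stmt5 {H : Type*} [NormedAddCommGroup H] [InnerProductSpace ℂ H] [CompleteSpace H]
    (M : VonNeumannAlgebra H)
    (hfactor : ∀ T ∈ M, T ∈ M.commutant → ∃ c : ℂ, T = c • (1 : H →L[ℂ] H))
    (x : H) (hx : ‖x‖ = 1)
    (hcyclic : closure {y : H | ∃ A ∈ M, y = A x} = Set.univ)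
    (hseparating : ∀ A ∈ M, A x = 0 → A = 0)
    (E : H →L[ℂ] H) (hE : ∀ y : H, E y = ⟪x, y⟫_ℂ • x)
    (𝒞 : Submodule ℂ (H →L[ℂ] H))
    (h𝒞 : 𝒞 = Submodule.span ℂ {T : H →L[ℂ] H | ∃ A ∈ M, ∃ B ∈ M, T = A ∘L E ∘L B})
    (T : H →L[ℂ] H) (hT𝒞 : T ∈ 𝒞) (hTsa : IsSelfAdjoint T) :
    ∃ (J : ℕ) (S : Fin J → (H →L[ℂ] H)) (c : Fin J → ℝ),
      (∀ j, S j ∈ M) ∧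
      (∀ j, IsSelfAdjoint (S j ∘L E ∘L ContinuousLinearMap.adjoint (S j)) ∧
        (S j ∘L E ∘L ContinuousLinearMap.adjoint (S j)) ∘L
          (S j ∘L E ∘L ContinuousLinearMap.adjoint (S j)) =
          S j ∘L E ∘L ContinuousLinearMap.adjoint (S j) ∧
        Module.finrank ℂ
          (LinearMap.range ((S j ∘L E ∘L ContinuousLinearMap.adjoint (S j)) : H →ₗ[ℂ] H)) = 1) ∧
      (∀ j k, j ≠ k →
        (S j ∘L E ∘L ContinuousLinearMap.adjoint (S j)) ∘L
          (S k ∘L E ∘L ContinuousLinearMap.adjoint (S k)) = 0) ∧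
      T = ∑ j, (c j : ℂ) • (S j ∘L E ∘L ContinuousLinearMap.adjoint (S j)) := by
  subst h𝒞
  obtain ⟨V, _, horb, hV⟩ :=
    exists_finiteDimensional_range_le M.toStarSubalgebra.toSubalgebra.toSubmodule x E hE T hT𝒞
  obtain ⟨n, e, c, he, heV, hTe⟩ := exists_orthonormal_eq_sum_of_isSelfAdjoint T hTsa V hV
  choose S hSM hSx using fun j => horb (e j) (heV j)
  have hP (j) : S j ∘L E ∘L adjoint (S j) = InnerProductSpace.rankOne ℂ (e j) (e j) := by
    ext y
    simp [hE, adjoint_inner_right, hSx]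
  refine ⟨n, S, c, hSM, fun j => ?_, fun j k hjk => ?_, ?_⟩
  · rw [hP]
    have hproj := InnerProductSpace.isStarProjection_rankOne_self (𝕜 := ℂ) (he.1 j)
    refine ⟨hproj.isSelfAdjoint, hproj.isIdempotentElem, ?_⟩
    have hrange : LinearMap.range (InnerProductSpace.rankOne ℂ (e j) (e j) : H →ₗ[ℂ] H) =
        ℂ ∙ e j := by
      refine le_antisymm ?_ ?_
      · rintro _ ⟨y, rfl⟩
        exact Submodule.mem_span_singleton.2 ⟨⟪e j, y⟫_ℂ, rfl⟩
      · rw [Submodule.span_singleton_le_iff_mem]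
        exact ⟨e j, by simp [he.1 j]⟩
    rw [hrange]
    exact finrank_span_singleton (he.ne_zero j)
  · rw [hP, hP]
    ext y
    simp [he.2 hjk]
  · ext y
    simp [hP, hTe]
end

section
/- Let A_1,...,A_k, B_1,...,B_k ∈ M. Then Σ_{i=1}^k A_i ∘ C ∘ B_i = 0 for every C ∈ M if and only if Σ_{i=1}^k B_i ∘ E ∘ A_i = 0. Equivalently, the linear map sending the map φ(C) = Σ_i A_i C B_i on M to the operator D_φ = Σ_i B_i ∘ E ∘ A_i ∈ 𝒞 is well defined and injective. -/
open scoped InnerProductSpace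
open ContinuousLinearMap

section

variable {H : Type*} [NormedAddCommGroup H] [InnerProductSpace ℂ H]

/-- The diagonal action of an operator on a finite direct sum of copies of a Hilbert space. -/
noncomputable def diagonalAction {n : ℕ} (T : H →L[ℂ] H) (v : PiLp 2 fun _ : Fin n => H) :
    PiLp 2 fun _ : Fin n => H :=
  WithLp.toLp 2 fun j => T (v j)

theorem inner_diagonalAction [CompleteSpace H] {n : ℕ} (T : H →L[ℂ] H)
    (u v : PiLp 2 fun _ : Fin n => H) :
    ⟪u, diagonalAction T v⟫_ℂ = ⟪diagonalAction (star T) u, v⟫_ℂ := by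
  simp [PiLp.inner_apply, diagonalAction, ContinuousLinearMap.star_eq_adjoint,
    ContinuousLinearMap.adjoint_inner_left]

theorem diagonalAction_sub {n : ℕ} (T : H →L[ℂ] H) (u v : PiLp 2 fun _ : Fin n => H) :
    diagonalAction T (u - v) = diagonalAction T u - diagonalAction T v := by
  ext j
  simp [diagonalAction]

theorem diagonalAction_mem_orthogonal [CompleteSpace H] {n : ℕ} {T : H →L[ℂ] H}
    {K : Submodule ℂ (PiLp 2 fun _ : Fin n => H)}
    (hK : ∀ v ∈ K, diagonalAction (star T) v ∈ K) :
    ∀ v ∈ Kᗮ, diagonalAction T v ∈ Kᗮ := by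
  intro v hv
  rw [Submodule.mem_orthogonal] at hv ⊢
  intro u hu
  rw [inner_diagonalAction]
  exact hv _ (hK u hu)

theorem starProjection_diagonalAction [CompleteSpace H] {n : ℕ} {T : H →L[ℂ] H}
    {W : Submodule ℂ (PiLp 2 fun _ : Fin n => H)} [W.HasOrthogonalProjection]
    (hT : ∀ v ∈ W, diagonalAction T v ∈ W)
    (hT' : ∀ v ∈ W, diagonalAction (star T) v ∈ W) (v : PiLp 2 fun _ : Fin n => H) :
    W.starProjection (diagonalAction T v) = diagonalAction T (W.starProjection v) := by
  apply Submodule.eq_starProjection_of_mem_orthogonal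
  · exact hT _ (W.starProjection_apply_mem v)
  · rw [← diagonalAction_sub]
    exact diagonalAction_mem_orthogonal hT' _ (W.sub_starProjection_mem_orthogonal v)

/-- The inclusion of the `l`-th summand of a finite direct sum of copies of a Hilbert space. -/
noncomputable def summandInclusion {n : ℕ} (l : Fin n) : H →L[ℂ] PiLp 2 fun _ : Fin n => H :=
  ((PiLp.continuousLinearEquiv 2 ℂ fun _ : Fin n => H).symm : _ →L[ℂ] _) ∘L
    ContinuousLinearMap.single ℂ (fun _ : Fin n => H) l

theorem summandInclusion_apply {n : ℕ} (l : Fin n) (y : H) :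
    summandInclusion l y = WithLp.toLp 2 (Pi.single l y) := rfl

theorem diagonalAction_summandInclusion {n : ℕ} (T : H →L[ℂ] H) (l : Fin n) (y : H) :
    diagonalAction T (summandInclusion l y) = summandInclusion l (T y) := by
  ext j
  by_cases h : j = l
  · subst h
    simp [diagonalAction, summandInclusion_apply]
  · simp [diagonalAction, summandInclusion_apply, h]

theorem sum_summandInclusion {n : ℕ} (v : PiLp 2 fun _ : Fin n => H) :
    ∑ l, summandInclusion l (v l) = v := by
  ext j
  simp [summandInclusion_apply, Finset.sum_apply, Pi.single_apply]

/-- A projection commuting with the diagonal actions of a factor and of its commutant is given by a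
scalar matrix. -/
theorem exists_scalar_matrix_of_commute_diagonalAction [CompleteSpace H] (M : VonNeumannAlgebra H)
    (hfactor : ∀ T ∈ M, T ∈ M.commutant → ∃ c : ℂ, T = c • (1 : H →L[ℂ] H)) {n : ℕ}
    (Q : (PiLp 2 fun _ : Fin n => H) →L[ℂ] PiLp 2 fun _ : Fin n => H)
    (hM : ∀ T ∈ M, ∀ v, Q (diagonalAction T v) = diagonalAction T (Q v))
    (hM' : ∀ T ∈ M.commutant, ∀ v, Q (diagonalAction T v) = diagonalAction T (Q v)) :
    ∃ q : Fin n → Fin n → ℂ, ∀ v j, Q v j = ∑ l, q j l • v l := by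
  let p (j l : Fin n) : H →L[ℂ] H :=
    PiLp.proj 2 (fun _ : Fin n => H) j ∘L Q ∘L summandInclusion l
  have hp (j l : Fin n) (T : H →L[ℂ] H)
      (hT : ∀ v, Q (diagonalAction T v) = diagonalAction T (Q v)) : T * p j l = p j l * T := by
    ext y
    change T (Q (summandInclusion l y) j) = Q (summandInclusion l (T y)) j
    rw [← diagonalAction_summandInclusion, hT]
    rfl
  have hscalar (j l : Fin n) : ∃ c : ℂ, p j l = c • (1 : H →L[ℂ] H) := by
    refine hfactor _ ?_ ?_
    · rw [← M.commutant_commutant, VonNeumannAlgebra.mem_commutant_iff]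
      exact fun T hT => hp j l T (hM' T hT)
    · rw [VonNeumannAlgebra.mem_commutant_iff]
      exact fun T hT => hp j l T (hM T hT)
  choose q hq using hscalar
  refine ⟨q, fun v j => ?_⟩
  have hterm (l : Fin n) : Q (summandInclusion l (v l)) j = q j l • v l := by
    change p j l (v l) = _
    rw [hq]
    rfl
  conv_lhs => rw [← sum_summandInclusion v, map_sum]
  rw [WithLp.ofLp_sum, Finset.sum_apply]
  exact Finset.sum_congr rfl fun l _ => hterm l

/-- The subspace of a finite direct sum generated by the vectors `(C b₁ y, …, C bₙ y)`, `C ∈ M`. -/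
def orbitSpan [CompleteSpace H] (M : VonNeumannAlgebra H) {n : ℕ} (b : Fin n → (H →L[ℂ] H)) :
    Submodule ℂ (PiLp 2 fun _ : Fin n => H) :=
  Submodule.span ℂ {v | ∃ C ∈ M, ∃ y : H, v = WithLp.toLp 2 fun j => C (b j y)}

theorem mem_orbitSpan_orthogonal [CompleteSpace H] {M : VonNeumannAlgebra H} {n : ℕ}
    {b : Fin n → (H →L[ℂ] H)} {v : PiLp 2 fun _ : Fin n => H} :
    v ∈ (orbitSpan M b)ᗮ ↔ ∀ C ∈ M, ∀ y : H, ∑ j, ⟪C (b j y), v j⟫_ℂ = 0 := by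
  rw [Submodule.mem_orthogonal]
  constructor
  · intro h C hC y
    simpa [PiLp.inner_apply] using h _ (Submodule.subset_span ⟨C, hC, y, rfl⟩)
  · intro h u hu
    induction hu using Submodule.span_induction with
    | mem u hu =>
      obtain ⟨C, hC, y, rfl⟩ := hu
      simpa [PiLp.inner_apply] using h C hC y
    | zero => simp
    | add u w _ _ hu hw => rw [inner_add_left, hu, hw, add_zero]
    | smul c u _ hu => rw [inner_smul_left, hu, mul_zero]

/-- A scalar matrix annihilating `b` on one side and fixing, on the other side, every
row `a` with `∑ aⱼ C bⱼ = 0` for all `C` in the factor `M`. -/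
theorem exists_scalar_matrix_of_factor [CompleteSpace H] (M : VonNeumannAlgebra H)
    (hfactor : ∀ T ∈ M, T ∈ M.commutant → ∃ c : ℂ, T = c • (1 : H →L[ℂ] H)) {n : ℕ}
    (b : Fin n → (H →L[ℂ] H)) (hb : ∀ j, b j ∈ M) :
    ∃ q : Fin n → Fin n → ℂ, (∀ j, ∑ l, q j l • b l = 0) ∧
      ∀ a : Fin n → (H →L[ℂ] H), (∀ C ∈ M, ∑ j, a j ∘L C ∘L b j = 0) →
        ∀ l, ∑ j, q j l • a j = a l := by
  obtain ⟨W, hW⟩ : ∃ W, W = (orbitSpan M b)ᗮ := ⟨_, rfl⟩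
  have hcomplete : CompleteSpace W := by
    rw [hW]
    exact (Submodule.isClosed_orthogonal _).completeSpace_coe
  have hproj : W.HasOrthogonalProjection := .ofCompleteSpace W
  have hM : ∀ T ∈ M, ∀ v ∈ W, diagonalAction T v ∈ W := by
    intro T hT v hv
    rw [hW, mem_orbitSpan_orthogonal] at hv ⊢
    intro C hC y
    simpa [diagonalAction, ContinuousLinearMap.star_eq_adjoint,
      ContinuousLinearMap.adjoint_inner_left] using hv (star T * C) (mul_mem (star_mem hT) hC) y
  have hM' : ∀ T ∈ M.commutant, ∀ v ∈ W, diagonalAction T v ∈ W := by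
    intro T hT v hv
    rw [hW, mem_orbitSpan_orthogonal] at hv ⊢
    intro C hC y
    rw [← hv C hC (star T y)]
    refine Finset.sum_congr rfl fun j _ => ?_
    have hcomm := VonNeumannAlgebra.mem_commutant_iff.mp (star_mem hT) (C * b j)
      (mul_mem hC (hb j))
    have happ : C (b j (star T y)) = star T (C (b j y)) := DFunLike.congr_fun hcomm y
    rw [happ, ContinuousLinearMap.star_eq_adjoint, ContinuousLinearMap.adjoint_inner_left]
    rfl
  obtain ⟨q, hq⟩ := exists_scalar_matrix_of_commute_diagonalAction M hfactor W.starProjection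
    (fun T hT => starProjection_diagonalAction (hM T hT) (hM _ (star_mem hT)))
    (fun T hT => starProjection_diagonalAction (hM' T hT) (hM' _ (star_mem hT)))
  refine ⟨q, fun j => ?_, fun a ha l => ?_⟩
  · ext y
    have hmem : (WithLp.toLp 2 fun l => b l y) ∈ orbitSpan M b :=
      Submodule.subset_span ⟨1, one_mem M, y, rfl⟩
    have hzero : W.starProjection (WithLp.toLp 2 fun l => b l y) = 0 :=
      Submodule.eq_starProjection_of_mem_orthogonal W.zero_mem
        (by
          rw [sub_zero, hW]
          exact (orbitSpan M b).le_orthogonal_orthogonal hmem)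
    have h := hq (WithLp.toLp 2 fun l => b l y) j
    rw [hzero] at h
    simpa using h.symm
  · ext y
    refine ext_inner_left ℂ fun z => ?_
    have hz : (WithLp.toLp 2 fun j => adjoint (a j) z) ∈ W := by
      rw [hW, mem_orbitSpan_orthogonal]
      intro C hC w
      have h : ∑ j, a j (C (b j w)) = 0 := by simpa using DFunLike.congr_fun (ha C hC) w
      simp only [ContinuousLinearMap.adjoint_inner_right]
      rw [← sum_inner, h, inner_zero_left]
    have h := (Submodule.mem_orthogonal _ _).mp
      (W.sub_starProjection_mem_orthogonal (summandInclusion l y)) _ hz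
    rw [inner_sub_right, sub_eq_zero] at h
    simp only [PiLp.inner_apply, ContinuousLinearMap.adjoint_inner_left, hq,
      summandInclusion_apply] at h
    rw [Finset.sum_eq_single l (by intro j _ hj; simp [hj]) (by simp)] at h
    simp only [Pi.single_eq_same, Pi.single_apply, smul_ite, smul_zero, Finset.sum_ite_eq',
      Finset.mem_univ, if_true, map_smul] at h
    simpa [inner_sum] using h.symm

/-- If `x` is separating for `M` and `∑ ⟪x, Aᵢ y⟫ Bᵢ = 0` for every vector `y`, then
`∑ Aᵢ C Bᵢ = 0` for every operator `C`. -/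
theorem sum_comp_comp_eq_zero_of_separating [CompleteSpace H] (M : VonNeumannAlgebra H) (x : H)
    (hseparating : ∀ A ∈ M, A x = 0 → A = 0) {k : ℕ} (A B : Fin k → (H →L[ℂ] H))
    (hA : ∀ i, A i ∈ M) (hAB : ∀ y : H, ∑ i, ⟪x, A i y⟫_ℂ • B i = 0) (C : H →L[ℂ] H) :
    ∑ i, A i ∘L C ∘L B i = 0 := by
  let S := Submodule.span ℂ (Set.range B)
  have hfinite : Module.Finite ℂ S := FiniteDimensional.span_of_finite ℂ (Set.finite_range B)
  let β := Module.finBasis ℂ S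
  let B' (i : Fin k) : S := ⟨B i, Submodule.subset_span ⟨i, rfl⟩⟩
  have hB' (y : H) : ∑ i, ⟪x, A i y⟫_ℂ • B' i = 0 := by
    apply Subtype.ext
    simpa [B'] using hAB y
  have hcomb (j) : ∑ i, β.repr (B' i) j • A i = 0 := by
    set D := ∑ i, β.repr (B' i) j • A i with hD
    have hDM : D ∈ M := sum_mem fun i _ => M.toStarSubalgebra.smul_mem (hA i) _
    have hinner (y : H) : ⟪x, D y⟫_ℂ = 0 := by
      have h := congrArg (fun s => β.repr s j) (hB' y)
      simpa [hD, inner_sum, inner_smul_right, mul_comm] using h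
    rw [← star_eq_zero]
    refine hseparating _ (star_mem hDM) (ext_inner_right ℂ fun y => ?_)
    rw [ContinuousLinearMap.star_eq_adjoint, ContinuousLinearMap.adjoint_inner_left, hinner,
      inner_zero_left]
  have hBsum (i : Fin k) : B i = ∑ j, β.repr (B' i) j • (β j : H →L[ℂ] H) := by
    have h := congrArg S.subtype (β.sum_repr (B' i))
    rw [map_sum] at h
    exact h.symm
  calc ∑ i, A i ∘L C ∘L B i
      = ∑ i, ∑ j, (β.repr (B' i) j • A i) ∘L C ∘L (β j : H →L[ℂ] H) := by
        refine Finset.sum_congr rfl fun i _ => ?_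
        conv_lhs => rw [hBsum i]
        ext y
        simp
    _ = ∑ j, (∑ i, β.repr (B' i) j • A i) ∘L C ∘L (β j : H →L[ℂ] H) := by
        rw [Finset.sum_comm]
        refine Finset.sum_congr rfl fun j _ => ?_
        ext y
        simp
    _ = 0 := by simp [hcomb]

end

/-- for `A₁,…,A_k, B₁,…,B_k ∈ M`, the map `C ↦ Σᵢ Aᵢ C Bᵢ` vanishes on `M`
iff `Σᵢ Bᵢ ∘ E ∘ Aᵢ = 0`; hence `φ ↦ D_φ` is well defined and injective. -/
theorem stmt9 {H : Type*} [NormedAddCommGroup H] [InnerProductSpace ℂ H] [CompleteSpace H]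
    (M : VonNeumannAlgebra H)
    (hfactor : ∀ T ∈ M, T ∈ M.commutant → ∃ c : ℂ, T = c • (1 : H →L[ℂ] H))
    (x : H) (hx : ‖x‖ = 1)
    (hcyclic : closure {y : H | ∃ A ∈ M, y = A x} = Set.univ)
    (hseparating : ∀ A ∈ M, A x = 0 → A = 0)
    (E : H →L[ℂ] H) (hE : ∀ y : H, E y = ⟪x, y⟫_ℂ • x)
    (k : ℕ) (A B : Fin k → (H →L[ℂ] H)) (hA : ∀ i, A i ∈ M) (hB : ∀ i, B i ∈ M) :
    (∀ C ∈ M, ∑ i, A i ∘L C ∘L B i = 0) ↔ ∑ i, B i ∘L E ∘L A i = 0 := by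
  have hE_comp (D : H →L[ℂ] H) (F : H →L[ℂ] H) (y : H) :
      (D ∘L E ∘L F) y = ⟪x, F y⟫_ℂ • D x := by simp [hE]
  constructor
  · intro h
    obtain ⟨q, hqB, hqA⟩ := exists_scalar_matrix_of_factor M hfactor B hB
    have hqA' := hqA A h
    calc ∑ l, B l ∘L E ∘L A l = ∑ l, ∑ j, (q j l • B l) ∘L E ∘L A j := by
          refine Finset.sum_congr rfl fun l _ => ?_
          conv_lhs => rw [← hqA' l]
          ext y
          simp
      _ = ∑ j, (∑ l, q j l • B l) ∘L E ∘L A j := by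
          rw [Finset.sum_comm]
          refine Finset.sum_congr rfl fun j _ => ?_
          ext y
          simp
      _ = 0 := by simp [hqB]
  · intro h C _
    refine sum_comp_comp_eq_zero_of_separating M x hseparating A B hA (fun y => ?_) C
    refine hseparating _ (sum_mem fun i _ => M.toStarSubalgebra.smul_mem (hB i) _) ?_
    have hy := DFunLike.congr_fun h y
    rw [sum_apply] at hy
    simpa only [hE_comp, sum_apply, smul_apply,
      zero_apply] using hy
end

section
/- Let A_1,...,A_k, B_1,...,B_k ∈ M and define D_φ = Σ_{i=1}^k B_i ∘ E ∘ A_i. Then D_φ is a positive operator (⟪D_φ y, y⟫ ≥ 0 for all y ∈ H) if and only if there exist finitely many operators V_1,...,V_r ∈ M such that Σ_{i=1}^k A_i ∘ C ∘ B_i = Σ_{j=1}^r V_j* ∘ C ∘ V_j for every C ∈ M. -/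
open scoped InnerProductSpace ComplexOrder
open ContinuousLinearMap

section

variable {H : Type*} [NormedAddCommGroup H] [InnerProductSpace ℂ H]

/-- A positive operator with range in a finite-dimensional subspace `W` is a finite sum of
operators `|v⟩⟨v|` with `v ∈ W`. -/
lemma exists_eq_sum_inner_smul_of_nonneg {D : H →L[ℂ] H} {W : Submodule ℂ H}
    [FiniteDimensional ℂ W] (hW : ∀ y, D y ∈ W) (hD : ∀ y, 0 ≤ ⟪D y, y⟫_ℂ) :
    ∃ (r : ℕ) (v : Fin r → H), (∀ j, v j ∈ W) ∧ ∀ y, D y = ∑ j, ⟪v j, y⟫_ℂ • v j := by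
  have hpos : D.IsPositive := (isPositive_iff_complex D).2 fun y ↦
    ⟨(Complex.eq_re_of_ofReal_le (r := 0) (by simpa using hD y)).symm, (Complex.le_def.1 (hD y)).1⟩
  let T : W →L[ℂ] W := (D ∘L W.subtypeL).codRestrict W fun y ↦ hW y
  have hTD (w : W) : (T w : H) = D w := rfl
  have hTpos : T.IsPositive :=
    (isPositive_iff_complex T).2 fun y ↦ (isPositive_iff_complex D).1 hpos y
  obtain ⟨r, u, hu⟩ := isPositive_iff_eq_sum_rankOne.1 hTpos
  refine ⟨r, fun j ↦ u j, fun j ↦ (u j).2, fun y ↦ ?_⟩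
  have hker {z : H} (hz : z ∈ Wᗮ) : D z = 0 := by
    refine ext_inner_right ℂ fun w ↦ ?_
    have : ⟪D z, w⟫_ℂ = ⟪z, D w⟫_ℂ := hpos.isSymmetric z w
    rw [this, inner_zero_left]
    exact (Submodule.mem_orthogonal' _ _).1 hz _ (hW w)
  have hy : D y = D (W.starProjection y) := by
    rw [← sub_eq_zero, ← map_sub]
    exact hker (W.sub_starProjection_mem_orthogonal y)
  have hin (j : Fin r) : ⟪(u j : H), W.starProjection y⟫_ℂ = ⟪(u j : H), y⟫_ℂ := by
    rw [← Submodule.inner_starProjection_left_eq_right,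
      Submodule.starProjection_eq_self_iff.2 (u j).2]
  have := congrArg (fun R : W →L[ℂ] W ↦ (R ⟨_, W.starProjection_apply_mem y⟩ : H)) hu
  simpa [hTD, ← hy, hin] using this

/-- The diagonal action of an operator on `H^ι`. -/
def diagAct {ι : Type*} (T : H →L[ℂ] H) (v : PiLp 2 fun _ : ι ↦ H) : PiLp 2 fun _ : ι ↦ H :=
  WithLp.toLp 2 fun i ↦ T (v i)

@[simp]
lemma diagAct_apply {ι : Type*} (T : H →L[ℂ] H) (v : PiLp 2 fun _ : ι ↦ H) (i : ι) :
    diagAct T v i = T (v i) := rfl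

variable [CompleteSpace H]

lemma diagAct_starProjection {ι : Type*} [Fintype ι] {K : Submodule ℂ (PiLp 2 fun _ : ι ↦ H)}
    [K.HasOrthogonalProjection] {T : H →L[ℂ] H} (hT : ∀ v ∈ K, diagAct T v ∈ K)
    (hT' : ∀ v ∈ K, diagAct (adjoint T) v ∈ K) (v : PiLp 2 fun _ : ι ↦ H) :
    K.starProjection (diagAct T v) = diagAct T (K.starProjection v) := by
  refine Submodule.eq_starProjection_of_mem_orthogonal (hT _ (K.starProjection_apply_mem v)) ?_
  have hsub : diagAct T v - diagAct T (K.starProjection v) =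
      diagAct T (v - K.starProjection v) := by
    ext i; simp
  rw [hsub, Submodule.mem_orthogonal]
  intro w hw
  have := (Submodule.mem_orthogonal _ _).1 (K.sub_starProjection_mem_orthogonal v) _ (hT' w hw)
  simpa [PiLp.inner_apply, adjoint_inner_left] using this

/-- In a factor, a self-adjoint projection of `H^ι` commuting with the diagonal action of the
factor and of its commutant is a Hermitian matrix of scalars. -/
lemma exists_scalar_matrix_starProjection [Nontrivial H] {M : VonNeumannAlgebra H}
    (hfactor : ∀ T ∈ M, T ∈ M.commutant → ∃ c : ℂ, T = c • (1 : H →L[ℂ] H))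
    {ι : Type*} [Fintype ι] (K : Submodule ℂ (PiLp 2 fun _ : ι ↦ H))
    [K.HasOrthogonalProjection] (hM : ∀ T ∈ M, ∀ v ∈ K, diagAct T v ∈ K)
    (hM' : ∀ T ∈ M.commutant, ∀ v ∈ K, diagAct T v ∈ K) :
    ∃ q : ι → ι → ℂ, (∀ i j, starRingEnd ℂ (q i j) = q j i) ∧
      ∀ v i, K.starProjection v i = ∑ j, q i j • v j := by
  classical
  let Q : ι → ι → (H →L[ℂ] H) := fun i j ↦ PiLp.proj 2 (fun _ : ι ↦ H) i ∘L K.starProjection ∘L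
    ((PiLp.continuousLinearEquiv 2 ℂ fun _ : ι ↦ H).symm : _ →L[ℂ] _) ∘L
      ContinuousLinearMap.single ℂ (fun _ : ι ↦ H) j
  have hQ (i j : ι) (u : H) : Q i j u = K.starProjection (PiLp.single 2 j u) i := rfl
  have hcomm (T : H →L[ℂ] H) (h : ∀ v ∈ K, diagAct T v ∈ K)
      (h' : ∀ v ∈ K, diagAct (adjoint T) v ∈ K) (i j : ι) : T * Q i j = Q i j * T := by
    ext u
    have := congrArg (· i) (diagAct_starProjection h h' (PiLp.single 2 j u))
    have hs : diagAct T (PiLp.single 2 j u : PiLp 2 fun _ : ι ↦ H) = PiLp.single 2 j (T u) := by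
      ext l
      by_cases hl : l = j
      · subst hl; simp
      · simp [hl]
    rw [hs] at this
    simpa [hQ] using this.symm
  have hscalar (i j : ι) : ∃ c : ℂ, Q i j = c • (1 : H →L[ℂ] H) := by
    refine hfactor _ ?_ ?_
    · rw [← M.commutant_commutant, VonNeumannAlgebra.mem_commutant_iff]
      exact fun T hT ↦ hcomm T (hM' T hT) (hM' _ (star_mem hT)) i j
    · rw [VonNeumannAlgebra.mem_commutant_iff]
      exact fun T hT ↦ hcomm T (hM T hT) (hM _ (star_mem hT)) i j
  choose q hq using hscalar
  refine ⟨q, fun i j ↦ ?_, fun v i ↦ ?_⟩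
  · obtain ⟨u, hu⟩ := exists_ne (0 : H)
    have h := K.inner_starProjection_left_eq_right (PiLp.single 2 j u) (PiLp.single 2 i u)
    have hl (w : PiLp 2 fun _ : ι ↦ H) (l : ι) : ⟪w, PiLp.single 2 l u⟫_ℂ = ⟪w l, u⟫_ℂ := by
      rw [PiLp.inner_apply, Finset.sum_eq_single l] <;> simp +contextual
    have hr (w : PiLp 2 fun _ : ι ↦ H) (l : ι) : ⟪PiLp.single 2 l u, w⟫_ℂ = ⟪u, w l⟫_ℂ := by
      rw [PiLp.inner_apply, Finset.sum_eq_single l] <;> simp +contextual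
    rw [hl, hr, ← hQ, ← hQ, hq, hq] at h
    have hu' : (‖u‖ : ℂ) ^ 2 ≠ 0 := by simpa using hu
    refine mul_left_cancel₀ hu' ?_
    simpa [inner_smul_left, inner_smul_right, mul_comm] using h
  · have hv : v = ∑ j, PiLp.single 2 j (v j) := by
      ext l
      simp [Pi.single_apply]
    conv_lhs => rw [hv, map_sum]
    simp [← hQ, hq]

/-- In a factor, the elementary operator `C ↦ ∑ᵢ Aᵢ C Bᵢ` determines the tensor
`∑ᵢ Aᵢ ⊗ Bᵢ`. -/
lemma sum_inner_smul_eq_zero_of_elementary_eq_zero [Nontrivial H] {M : VonNeumannAlgebra H}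
    (hfactor : ∀ T ∈ M, T ∈ M.commutant → ∃ c : ℂ, T = c • (1 : H →L[ℂ] H))
    {ι : Type*} [Fintype ι] {A B : ι → (H →L[ℂ] H)} (hB : ∀ i, B i ∈ M)
    (h : ∀ C ∈ M, ∑ i, A i ∘L C ∘L B i = 0) (x y z : H) :
    ∑ i, ⟪x, A i y⟫_ℂ • B i z = 0 := by
  let S : Set (PiLp 2 fun _ : ι ↦ H) :=
    {v | ∃ C ∈ M, ∃ ξ, v = WithLp.toLp 2 fun i ↦ C (B i ξ)}
  let K := (Submodule.span ℂ S)ᗮ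
  have : CompleteSpace K := Submodule.instOrthogonalCompleteSpace _
  have : K.HasOrthogonalProjection := Submodule.HasOrthogonalProjection.ofCompleteSpace K
  have hK (v : PiLp 2 fun _ : ι ↦ H) :
      v ∈ K ↔ ∀ C ∈ M, ∀ ξ, ∑ i, ⟪C (B i ξ), v i⟫_ℂ = 0 := by
    refine ⟨fun hv C hC ξ ↦ ?_, fun hv ↦ ?_⟩
    · have := (Submodule.mem_orthogonal _ _).1 hv _ (Submodule.subset_span ⟨C, hC, ξ, rfl⟩)
      simpa [PiLp.inner_apply] using this
    · rw [Submodule.mem_orthogonal]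
      intro u hu
      induction hu using Submodule.span_induction with
      | mem u hu =>
        obtain ⟨C, hC, ξ, rfl⟩ := hu
        simpa [PiLp.inner_apply] using hv C hC ξ
      | zero => simp
      | add u w _ _ hu hw => rw [inner_add_left, hu, hw, add_zero]
      | smul c u _ hu => rw [inner_smul_left, hu, mul_zero]
  obtain ⟨q, hq, hKq⟩ := exists_scalar_matrix_starProjection hfactor K
    (fun T hT v hv ↦ (hK _).2 fun C hC ξ ↦ by
      have := (hK v).1 hv _ (mul_mem (star_mem hT) hC) ξ
      simpa [star_eq_adjoint, adjoint_inner_left] using this)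
    (fun T hT v hv ↦ (hK _).2 fun C hC ξ ↦ by
      have hT' := VonNeumannAlgebra.mem_commutant_iff.1 (star_mem hT)
      have := (hK v).1 hv C hC (star T ξ)
      have hc (i : ι) : C (B i (star T ξ)) = adjoint T (C (B i ξ)) :=
        congrArg (fun R : H →L[ℂ] H ↦ R ξ) (hT' _ (mul_mem hC (hB i)))
      simpa [hc, adjoint_inner_left] using this)
  have hqB (i : ι) : ∑ j, q i j • B j z = 0 := by
    have : K.starProjection (WithLp.toLp 2 fun i ↦ B i z) = 0 := by
      rw [Submodule.starProjection_apply_eq_zero_iff]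
      exact Submodule.le_orthogonal_orthogonal _
        (Submodule.subset_span ⟨1, one_mem M, z, rfl⟩)
    simpa [hKq] using congrArg (· i) this
  have hqA (i : ι) : ∑ j, q i j • adjoint (A j) x = adjoint (A i) x := by
    have : K.starProjection (WithLp.toLp 2 fun i ↦ adjoint (A i) x) =
        WithLp.toLp 2 fun i ↦ adjoint (A i) x := by
      rw [Submodule.starProjection_eq_self_iff, hK]
      intro C hC ξ
      have := congrArg (fun R : H →L[ℂ] H ↦ ⟪R ξ, x⟫_ℂ) (h C hC)
      simpa [adjoint_inner_right, sum_inner] using this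
    simpa [hKq] using congrArg (· i) this
  have hcoef (i : ι) : ⟪x, A i y⟫_ℂ = ∑ j, q j i * ⟪x, A j y⟫_ℂ := by
    rw [← adjoint_inner_left, ← hqA, sum_inner]
    simp [inner_smul_left, hq, adjoint_inner_left]
  calc ∑ i, ⟪x, A i y⟫_ℂ • B i z
      = ∑ i, ∑ j, ⟪x, A j y⟫_ℂ • q j i • B i z := by
        refine Finset.sum_congr rfl fun i _ ↦ ?_
        rw [hcoef, Finset.sum_smul]
        simp_rw [smul_smul, mul_comm]
    _ = ∑ j, ⟪x, A j y⟫_ℂ • ∑ i, q j i • B i z := by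
        rw [Finset.sum_comm]
        simp_rw [Finset.smul_sum]
    _ = 0 := by simp [hqB]

/-- If `x` is separating for `M`, then `∑ᵢ |Bᵢ x⟩⟨Aᵢ* x|` determines the elementary operator
`C ↦ ∑ᵢ Aᵢ C Bᵢ`. -/
lemma elementary_eq_zero_of_sum_inner_smul_eq_zero {M : VonNeumannAlgebra H} {x : H}
    (hseparating : ∀ A ∈ M, A x = 0 → A = 0)
    {ι : Type*} [Fintype ι] {A B : ι → (H →L[ℂ] H)} (hA : ∀ i, A i ∈ M) (hB : ∀ i, B i ∈ M)
    (h : ∀ y, ∑ i, ⟪x, A i y⟫_ℂ • B i x = 0) (C : H →L[ℂ] H) :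
    ∑ i, A i ∘L C ∘L B i = 0 := by
  have hsmul (c : ℂ) {T : H →L[ℂ] H} (hT : T ∈ M) : c • T ∈ M :=
    M.toStarSubalgebra.smul_mem hT c
  have hzero (w : H) : ∑ i, ⟪w, B i x⟫_ℂ • A i = 0 := by
    have hstar : star (∑ i, ⟪w, B i x⟫_ℂ • A i) = 0 := by
      refine hseparating _ (star_mem (sum_mem fun i _ ↦ hsmul _ (hA i))) ?_
      refine ext_inner_right ℂ fun y ↦ ?_
      have := congrArg (fun u ↦ ⟪w, u⟫_ℂ) (h y)
      simp only [inner_sum, inner_smul_right, inner_zero_right] at this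
      rw [star_eq_adjoint, adjoint_inner_left, inner_zero_left]
      simpa [inner_sum, inner_smul_right, mul_comm] using this
    exact star_eq_zero.1 hstar
  let W := Submodule.span ℂ (Set.range fun i ↦ B i x)
  have : FiniteDimensional ℂ W := .span_of_finite ℂ (Set.finite_range _)
  let e := stdOrthonormalBasis ℂ W
  have he (m) : ∃ G ∈ M, (e m : H) = G x := by
    obtain ⟨c, hc⟩ := (Submodule.mem_span_range_iff_exists_fun ℂ).1 (e m).2
    exact ⟨∑ i, c i • B i, sum_mem fun i _ ↦ hsmul _ (hB i), by simp [← hc]⟩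
  choose G hG heG using he
  have hBG (i : ι) : B i = ∑ m, ⟪(e m : H), B i x⟫_ℂ • G m := by
    refine sub_eq_zero.1 (hseparating _
      (sub_mem (hB i) (sum_mem fun m _ ↦ hsmul _ (hG m))) ?_)
    have := congrArg (Subtype.val) (e.sum_repr' ⟨B i x, Submodule.subset_span ⟨i, rfl⟩⟩)
    simp only [Submodule.coe_inner, AddSubmonoidClass.coe_finsetSum, Submodule.coe_smul] at this
    simp [← heG, this]
  ext z
  have hz (i : ι) : A i (C (B i z)) = ∑ m, ⟪(e m : H), B i x⟫_ℂ • A i (C (G m z)) := by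
    conv_lhs => rw [hBG i]
    simp
  simp only [sum_apply, coe_comp, Function.comp_apply, hz, zero_apply]
  rw [Finset.sum_comm]
  refine Finset.sum_eq_zero fun m _ ↦ ?_
  simpa using congrArg (fun R : H →L[ℂ] H ↦ R (C (G m z))) (hzero (e m))

end

/-- `D_φ = Σᵢ Bᵢ ∘ E ∘ Aᵢ` is a positive operator iff the map
`C ↦ Σᵢ Aᵢ C Bᵢ` on `M` admits a Kraus decomposition `C ↦ Σⱼ Vⱼ* C Vⱼ` with `Vⱼ ∈ M`. -/
theorem stmt10 {H : Type*} [NormedAddCommGroup H] [InnerProductSpace ℂ H] [CompleteSpace H]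
    (M : VonNeumannAlgebra H)
    (hfactor : ∀ T ∈ M, T ∈ M.commutant → ∃ c : ℂ, T = c • (1 : H →L[ℂ] H))
    (x : H) (hx : ‖x‖ = 1)
    (hcyclic : closure {y : H | ∃ A ∈ M, y = A x} = Set.univ)
    (hseparating : ∀ A ∈ M, A x = 0 → A = 0)
    (E : H →L[ℂ] H) (hE : ∀ y : H, E y = ⟪x, y⟫_ℂ • x)
    (k : ℕ) (A B : Fin k → (H →L[ℂ] H)) (hA : ∀ i, A i ∈ M) (hB : ∀ i, B i ∈ M) :
    (∀ y : H, 0 ≤ ⟪(∑ i, B i ∘L E ∘L A i) y, y⟫_ℂ) ↔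
    (∃ (r : ℕ) (V : Fin r → (H →L[ℂ] H)), (∀ j, V j ∈ M) ∧
      ∀ C ∈ M, ∑ i, A i ∘L C ∘L B i =
        ∑ j, ContinuousLinearMap.adjoint (V j) ∘L C ∘L V j) := by
  have : Nontrivial H := ⟨x, 0, by rintro rfl; simp at hx⟩
  have hD (y : H) : (∑ i, B i ∘L E ∘L A i) y = ∑ i, ⟪x, A i y⟫_ℂ • B i x := by
    simp [hE]
  have hadj (V : H →L[ℂ] H) (y : H) : ⟪x, adjoint V y⟫_ℂ = ⟪V x, y⟫_ℂ :=
    adjoint_inner_right V x y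
  constructor
  · intro hpos
    have : FiniteDimensional ℂ (Submodule.span ℂ (Set.range fun i ↦ B i x)) :=
      .span_of_finite ℂ (Set.finite_range _)
    obtain ⟨r, v, hv, hDv⟩ := exists_eq_sum_inner_smul_of_nonneg
      (W := Submodule.span ℂ (Set.range fun i ↦ B i x))
      (fun y ↦ by
        rw [hD]
        exact sum_mem fun i _ ↦ Submodule.smul_mem _ _ (Submodule.subset_span ⟨i, rfl⟩)) hpos
    have hV (j : Fin r) : ∃ V ∈ M, v j = V x := by
      obtain ⟨c, hc⟩ := (Submodule.mem_span_range_iff_exists_fun ℂ).1 (hv j)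
      exact ⟨∑ i, c i • B i,
        sum_mem fun i _ ↦ M.toStarSubalgebra.smul_mem (hB i) (c i), by simp [← hc]⟩
    choose V hVM hVx using hV
    refine ⟨r, V, hVM, fun C _ ↦ ?_⟩
    have := elementary_eq_zero_of_sum_inner_smul_eq_zero hseparating
      (A := Sum.elim A fun j ↦ -adjoint (V j)) (B := Sum.elim B V)
      (by rintro (i | j); exacts [hA i, neg_mem (star_mem (hVM j))])
      (by rintro (i | j); exacts [hB i, hVM j])
      (fun y ↦ by
        have := hDv y
        rw [hD] at this
        simp [Fintype.sum_sum_type, hadj, this, hVx]) C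
    simpa [Fintype.sum_sum_type, add_neg_eq_zero] using this
  · rintro ⟨r, V, hVM, hV⟩ y
    have := sum_inner_smul_eq_zero_of_elementary_eq_zero hfactor
      (A := Sum.elim A fun j ↦ -adjoint (V j)) (B := Sum.elim B V)
      (by rintro (i | j); exacts [hB i, hVM j])
      (fun C hC ↦ by simp [Fintype.sum_sum_type, hV C hC]) x y x
    have hDV : ∑ i, ⟪x, A i y⟫_ℂ • B i x = ∑ j, ⟪V j x, y⟫_ℂ • V j x := by
      simpa [Fintype.sum_sum_type, hadj, add_neg_eq_zero] using this
    rw [hD, hDV, sum_inner]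
    refine Finset.sum_nonneg fun j _ ↦ ?_
    rw [inner_smul_left, mul_comm, RCLike.mul_conj]
    positivity
end

section
/- Let A_1,...,A_k, B_1,...,B_k ∈ M. If Σ_{i=1}^k A_i ∘ C ∘ B_i is a positive operator for every positive operator C ∈ B(H), then D_φ = Σ_{i=1}^k B_i ∘ E ∘ A_i is a positive operator; consequently there exist V_1,...,V_r ∈ M with Σ_i A_i ∘ C ∘ B_i = Σ_j V_j* ∘ C ∘ V_j for all C ∈ M. -/
open scoped InnerProductSpace ComplexOrder
open ContinuousLinearMap

/-- Linearly independent vectors admit prescribed inner products with a single vector. -/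
lemma LinearIndependent.exists_inner_eq {H : Type*} [NormedAddCommGroup H]
    [InnerProductSpace ℂ H] {n : ℕ} {w : Fin n → H} (hw : LinearIndependent ℂ w)
    (c : Fin n → ℂ) : ∃ y : H, ∀ l, ⟪w l, y⟫_ℂ = c l := by
  have hu : IsUnit (Matrix.gram ℂ w) := (Matrix.posDef_gram_of_linearIndependent hw).isUnit
  obtain ⟨d, hd⟩ := Matrix.mulVec_surjective_iff_isUnit.mpr hu c
  refine ⟨∑ m, d m • w m, fun l => ?_⟩
  rw [← hd]
  rw [inner_sum]
  simp_rw [inner_smul_right]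
  simp [Matrix.mulVec, dotProduct, Matrix.gram_apply, mul_comm]

/-- A complex matrix with nonnegative quadratic form is positive semidefinite; hermitianity is
automatic. -/
lemma Matrix.posSemidef_of_forall_dotProduct_mulVec_nonneg {n : ℕ} {G : Matrix (Fin n) (Fin n) ℂ}
    (h : ∀ c : Fin n → ℂ, 0 ≤ star c ⬝ᵥ G.mulVec c) : G.PosSemidef := by
  rw [← Matrix.isPositive_toEuclideanLin_iff, LinearMap.isPositive_iff_complex]
  intro c
  have hc := star_nonneg_iff.mpr (h c.ofLp)
  have key : ⟪G.toEuclideanLin c, c⟫_ℂ = star (star c.ofLp ⬝ᵥ G.mulVec c.ofLp) := by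
    rw [EuclideanSpace.inner_eq_star_dotProduct, Matrix.star_dotProduct, dotProduct_comm]
    simp [dotProduct_comm]
  rw [key]
  obtain ⟨hre, him⟩ := Complex.nonneg_iff.mp hc
  exact ⟨Complex.ext (by simp) (by simpa using him), hre⟩

/-- The positivity of `C ↦ ∑ i, A i ∘ C ∘ B i` on the rank one operators gives nonnegativity of the
associated quadratic expression. -/
lemma sum_inner_mul_inner_nonneg {H : Type*} [NormedAddCommGroup H] [InnerProductSpace ℂ H]
    [CompleteSpace H] {k : ℕ} {A B : Fin k → (H →L[ℂ] H)}
    (hpos : ∀ C : H →L[ℂ] H, (∀ y : H, 0 ≤ ⟪C y, y⟫_ℂ) →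
      ∀ y : H, 0 ≤ ⟪(∑ i, A i ∘L C ∘L B i) y, y⟫_ℂ) (x y : H) :
    0 ≤ ∑ i, ⟪B i x, y⟫_ℂ * ⟪A i y, x⟫_ℂ := by
  have h := hpos (InnerProductSpace.rankOne ℂ y y)
    (fun z => (InnerProductSpace.isPositive_rankOne_self y).inner_nonneg_left z) x
  simpa [sum_apply, sum_inner, inner_smul_left, mul_comm] using h

/-- If `x` separates the span of the coefficients of a positive elementary operator, then that
operator is a sum of conjugations by elements of the span. -/
lemma exists_kraus_of_separating {H : Type*} [NormedAddCommGroup H] [InnerProductSpace ℂ H]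
    [CompleteSpace H] (S : Submodule ℂ (H →L[ℂ] H)) [FiniteDimensional ℂ S] (x : H)
    (hsep : ∀ T ∈ S, T x = 0 → T = 0) {k : ℕ} {A B : Fin k → (H →L[ℂ] H)}
    (hA : ∀ i, adjoint (A i) ∈ S) (hB : ∀ i, B i ∈ S)
    (hpos : ∀ y : H, 0 ≤ ∑ i, ⟪B i x, y⟫_ℂ * ⟪A i y, x⟫_ℂ) :
    ∃ (r : ℕ) (V : Fin r → (H →L[ℂ] H)), (∀ j, V j ∈ S) ∧
      ∀ C : H →L[ℂ] H, ∑ i, A i ∘L C ∘L B i = ∑ j, adjoint (V j) ∘L C ∘L V j := by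
  let W := Module.finBasis ℂ S
  let ev : S →ₗ[ℂ] H := (ContinuousLinearMap.apply ℂ H x).toLinearMap ∘ₗ S.subtype
  have hev : LinearMap.ker ev = ⊥ := by
    rw [LinearMap.ker_eq_bot']
    intro T hT
    exact Subtype.ext (hsep T T.2 hT)
  have hw : LinearIndependent ℂ (fun l => (W l : H →L[ℂ] H) x) :=
    W.linearIndependent.map' ev hev
  let a : Fin k → Fin _ → ℂ := fun i => W.repr ⟨_, hA i⟩
  let b : Fin k → Fin _ → ℂ := fun i => W.repr ⟨_, hB i⟩
  have hb : ∀ i, B i = ∑ l, b i l • (W l : H →L[ℂ] H) := fun i => by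
    have h := congrArg S.subtype (W.sum_repr ⟨_, hB i⟩).symm
    rwa [map_sum] at h
  have ha' : ∀ i, adjoint (A i) = ∑ l, a i l • (W l : H →L[ℂ] H) := fun i => by
    have h := congrArg S.subtype (W.sum_repr ⟨_, hA i⟩).symm
    rwa [map_sum] at h
  have ha : ∀ i, A i = ∑ l, star (a i l) • adjoint (W l : H →L[ℂ] H) := fun i => by
    rw [← adjoint_adjoint (A i), ha' i, map_sum]
    exact Finset.sum_congr rfl fun l _ => map_smulₛₗ _ _ _
  let G : Matrix (Fin _) (Fin _) ℂ := fun m l => ∑ i, star (a i m) * b i l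
  have hG : G.PosSemidef := by
    apply Matrix.posSemidef_of_forall_dotProduct_mulVec_nonneg
    intro c
    obtain ⟨y, hy⟩ := hw.exists_inner_eq (star c)
    have h := star_nonneg_iff.mpr (hpos y)
    convert h using 1
    have h1 : ∀ i, ⟪y, B i x⟫_ℂ = ∑ l, b i l * c l := fun i => by
      rw [hb i, sum_apply, inner_sum]
      refine Finset.sum_congr rfl fun l _ => ?_
      rw [smul_apply, inner_smul_right, ← inner_conj_symm, hy]
      simp
    have h2 : ∀ i, ⟪x, A i y⟫_ℂ = ∑ m, star (a i m) * star (c m) := fun i => by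
      rw [← adjoint_inner_left, ha' i, sum_apply, sum_inner]
      refine Finset.sum_congr rfl fun l _ => ?_
      rw [smul_apply, inner_smul_left, hy]
      simp
    have h3 : star (∑ i, ⟪B i x, y⟫_ℂ * ⟪A i y, x⟫_ℂ) = ∑ i, ⟪x, A i y⟫_ℂ * ⟪y, B i x⟫_ℂ := by
      simp [star_sum, mul_comm]
    rw [h3]
    simp_rw [h1, h2, Finset.sum_mul_sum, dotProduct, Matrix.mulVec, dotProduct, G, Finset.sum_mul,
      Finset.mul_sum]
    rw [Finset.sum_comm (s := (Finset.univ : Finset (Fin k)))]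
    refine Finset.sum_congr rfl fun m _ => ?_
    rw [Finset.sum_comm (s := (Finset.univ : Finset (Fin k)))]
    refine Finset.sum_congr rfl fun l _ => Finset.sum_congr rfl fun i _ => ?_
    simp only [Pi.star_apply]
    ring
  obtain ⟨r, v, hv⟩ := Matrix.posSemidef_iff_eq_sum_vecMulVec.mp hG
  refine ⟨r, fun j => ∑ l, star (v j l) • (W l : H →L[ℂ] H),
    fun j => S.sum_mem fun l _ => S.smul_mem _ (W l).2, fun C => ?_⟩
  have expand : ∀ {p : ℕ} (f g : Fin p → Fin _ → ℂ),
      ∑ i, (∑ m, f i m • adjoint (W m : H →L[ℂ] H)) ∘L C ∘L (∑ l, g i l • (W l : H →L[ℂ] H)) =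
        ∑ m, ∑ l, (∑ i, f i m * g i l) • (adjoint (W m : H →L[ℂ] H) ∘L C ∘L (W l)) := by
    intro p f g
    simp_rw [finsetSum_comp, comp_finsetSum, smul_comp, comp_smul, smul_smul, Finset.sum_smul]
    rw [Finset.sum_comm (s := (Finset.univ : Finset (Fin p)))]
    refine Finset.sum_congr rfl fun m _ => ?_
    rw [Finset.sum_comm (s := (Finset.univ : Finset (Fin p)))]
  have hl : ∑ i, A i ∘L C ∘L B i =
      ∑ m, ∑ l, G m l • (adjoint (W m : H →L[ℂ] H) ∘L C ∘L (W l)) := by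
    rw [← expand (fun i m => star (a i m)) b]
    exact Finset.sum_congr rfl fun i _ => by rw [ha i, hb i]
  have hr : ∀ j, adjoint (∑ l, star (v j l) • (W l : H →L[ℂ] H)) =
      ∑ m, v j m • adjoint (W m : H →L[ℂ] H) := fun j => by
    rw [map_sum]
    exact Finset.sum_congr rfl fun l _ => by rw [map_smulₛₗ]; simp
  simp_rw [hl, hr, expand, hv, Matrix.sum_apply, Matrix.vecMulVec_apply, Pi.star_apply]

/-- if `C ↦ Σᵢ Aᵢ C Bᵢ` is positive on all of `B(H)`, then
`D_φ = Σᵢ Bᵢ ∘ E ∘ Aᵢ` is a positive operator, and consequently the map admits a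
Kraus decomposition on `M`. -/
theorem stmt11 {H : Type*} [NormedAddCommGroup H] [InnerProductSpace ℂ H] [CompleteSpace H]
    (M : VonNeumannAlgebra H)
    (hfactor : ∀ T ∈ M, T ∈ M.commutant → ∃ c : ℂ, T = c • (1 : H →L[ℂ] H))
    (x : H) (hx : ‖x‖ = 1)
    (hcyclic : closure {y : H | ∃ A ∈ M, y = A x} = Set.univ)
    (hseparating : ∀ A ∈ M, A x = 0 → A = 0)
    (E : H →L[ℂ] H) (hE : ∀ y : H, E y = ⟪x, y⟫_ℂ • x)
    (k : ℕ) (A B : Fin k → (H →L[ℂ] H)) (hA : ∀ i, A i ∈ M) (hB : ∀ i, B i ∈ M)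
    (hpos : ∀ C : H →L[ℂ] H, (∀ y : H, 0 ≤ ⟪C y, y⟫_ℂ) →
      ∀ y : H, 0 ≤ ⟪(∑ i, A i ∘L C ∘L B i) y, y⟫_ℂ) :
    (∀ y : H, 0 ≤ ⟪(∑ i, B i ∘L E ∘L A i) y, y⟫_ℂ) ∧
    (∃ (r : ℕ) (V : Fin r → (H →L[ℂ] H)), (∀ j, V j ∈ M) ∧
      ∀ C ∈ M, ∑ i, A i ∘L C ∘L B i =
        ∑ j, ContinuousLinearMap.adjoint (V j) ∘L C ∘L V j) := by
  have hnn := sum_inner_mul_inner_nonneg hpos x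
  refine ⟨fun y => ?_, ?_⟩
  · simpa [sum_apply, sum_inner, hE, inner_smul_left, mul_comm] using hnn y
  · let S : Submodule ℂ (H →L[ℂ] H) :=
      Submodule.span ℂ (Set.range fun i => adjoint (A i)) ⊔ Submodule.span ℂ (Set.range B)
    have hSM : ∀ T ∈ S, T ∈ M := by
      have : S ≤ M.toStarSubalgebra.toSubalgebra.toSubmodule := by
        refine sup_le (Submodule.span_le.mpr ?_) (Submodule.span_le.mpr ?_)
        · rintro _ ⟨i, rfl⟩
          exact (star_mem (hA i) : star (A i) ∈ M)
        · rintro _ ⟨i, rfl⟩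
          exact hB i
      exact fun T hT => this hT
    have : FiniteDimensional ℂ (Submodule.span ℂ (Set.range fun i => adjoint (A i))) :=
      FiniteDimensional.span_of_finite ℂ (Set.finite_range _)
    have : FiniteDimensional ℂ (Submodule.span ℂ (Set.range B)) :=
      FiniteDimensional.span_of_finite ℂ (Set.finite_range _)
    obtain ⟨r, V, hV, h⟩ := exists_kraus_of_separating S x
      (fun T hT => hseparating T (hSM T hT))
      (fun i => Submodule.mem_sup_left (Submodule.subset_span ⟨i, rfl⟩))
      (fun i => Submodule.mem_sup_right (Submodule.subset_span ⟨i, rfl⟩)) hnn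
    exact ⟨r, V, fun j => hSM _ (hV j), fun C _ => h C⟩
end

section
/- Let A_1,...,A_k, B_1,...,B_k ∈ M. If Σ_{i=1}^k A_i ∘ C ∘ B_i is a positive operator for every positive operator C belonging to 𝒞, then Σ_{i=1}^k A_i ∘ C ∘ B_i is a positive operator for every positive operator C ∈ B(H). -/
open scoped InnerProductSpace ComplexOrder
open ContinuousLinearMap

/-- For a positive operator `C = S† S`, the sesquilinear form of `∑ᵢ Aᵢ C Bᵢ` decomposes along a
Hilbert basis into the forms of the rank-one operators given by the vectors `S† e`, so positivity
on rank-one operators implies positivity on `C`. -/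
theorem sum_inner_comp_nonneg_of_rankOne {H : Type*} [NormedAddCommGroup H]
    [InnerProductSpace ℂ H] [CompleteSpace H] {ι : Type*} [Fintype ι] (A B : ι → (H →L[ℂ] H))
    (y : H) (h : ∀ v : H, 0 ≤ ∑ i, ⟪B i y, v⟫_ℂ * ⟪v, adjoint (A i) y⟫_ℂ)
    (C : H →L[ℂ] H) (hC : ∀ z : H, 0 ≤ ⟪C z, z⟫_ℂ) :
    0 ≤ ⟪(∑ i, A i ∘L C ∘L B i) y, y⟫_ℂ := by
  have hC' : 0 ≤ C := by
    rw [nonneg_iff_isPositive, isPositive_iff_complex]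
    intro z
    have := Complex.nonneg_iff.mp (hC z)
    exact ⟨Complex.ext (by simp) (by simpa using this.2), this.1⟩
  obtain ⟨S, rfl⟩ := CStarAlgebra.nonneg_iff_eq_star_mul_self.mp hC'
  obtain ⟨w, b, -⟩ := exists_hilbertBasis ℂ H
  have hs : HasSum (fun j => ∑ i, ⟪S (B i y), b j⟫_ℂ * ⟪b j, S (adjoint (A i) y)⟫_ℂ)
      (∑ i, ⟪S (B i y), S (adjoint (A i) y)⟫_ℂ) :=
    hasSum_sum fun i _ => b.hasSum_inner_mul_inner _ _
  have he : ⟪(∑ i, A i ∘L (star S * S) ∘L B i) y, y⟫_ℂ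
      = ∑ i, ⟪S (B i y), S (adjoint (A i) y)⟫_ℂ := by
    simp [sum_apply, star_eq_adjoint, ← adjoint_inner_right]
  rw [he]
  refine hs.nonneg fun j => ?_
  simpa only [adjoint_inner_left S, adjoint_inner_right S] using h (adjoint S (b j))

/-- if `C ↦ Σᵢ Aᵢ C Bᵢ` sends every positive operator in `𝒞` to a positive
operator, then it sends every positive operator in `B(H)` to a positive operator. -/
theorem stmt14 {H : Type*} [NormedAddCommGroup H] [InnerProductSpace ℂ H] [CompleteSpace H]
    (M : VonNeumannAlgebra H)
    (hfactor : ∀ T ∈ M, T ∈ M.commutant → ∃ c : ℂ, T = c • (1 : H →L[ℂ] H))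
    (x : H) (hx : ‖x‖ = 1)
    (hcyclic : closure {y : H | ∃ A ∈ M, y = A x} = Set.univ)
    (hseparating : ∀ A ∈ M, A x = 0 → A = 0)
    (E : H →L[ℂ] H) (hE : ∀ y : H, E y = ⟪x, y⟫_ℂ • x)
    (𝒞 : Submodule ℂ (H →L[ℂ] H))
    (h𝒞 : 𝒞 = Submodule.span ℂ {T : H →L[ℂ] H | ∃ A ∈ M, ∃ B ∈ M, T = A ∘L E ∘L B})
    (k : ℕ) (A B : Fin k → (H →L[ℂ] H)) (hA : ∀ i, A i ∈ M) (hB : ∀ i, B i ∈ M)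
    (hpos𝒞 : ∀ C ∈ 𝒞, (∀ y : H, 0 ≤ ⟪C y, y⟫_ℂ) →
      ∀ y : H, 0 ≤ ⟪(∑ i, A i ∘L C ∘L B i) y, y⟫_ℂ) :
    ∀ C : H →L[ℂ] H, (∀ y : H, 0 ≤ ⟪C y, y⟫_ℂ) →
      ∀ y : H, 0 ≤ ⟪(∑ i, A i ∘L C ∘L B i) y, y⟫_ℂ := by
  refine fun C hC y => sum_inner_comp_nonneg_of_rankOne A B y (fun v => ?_) C hC
  have hclosed : IsClosed {v : H | 0 ≤ ∑ i, ⟪B i y, v⟫_ℂ * ⟪v, adjoint (A i) y⟫_ℂ} :=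
    isClosed_le continuous_const (by fun_prop)
  have hsub : closure {y : H | ∃ A ∈ M, y = A x} ⊆
      {v : H | 0 ≤ ∑ i, ⟪B i y, v⟫_ℂ * ⟪v, adjoint (A i) y⟫_ℂ} := by
    refine closure_minimal ?_ hclosed
    rintro _ ⟨T, hT, rfl⟩
    have hrank : ∀ z, (T ∘L E ∘L star T) z = ⟪T x, z⟫_ℂ • T x := fun z => by
      simp [hE, star_eq_adjoint, adjoint_inner_right]
    have hmem : T ∘L E ∘L star T ∈ 𝒞 := by
      rw [h𝒞]
      exact Submodule.subset_span ⟨T, hT, star T, star_mem hT, rfl⟩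
    have hpos := hpos𝒞 _ hmem (fun z => by
      rw [hrank, inner_smul_left, inner_conj_symm, ← inner_conj_symm z (T x)]
      exact star_mul_self_nonneg _) y
    have heq : ⟪(∑ i, A i ∘L (T ∘L E ∘L star T) ∘L B i) y, y⟫_ℂ
        = ∑ i, ⟪B i y, T x⟫_ℂ * ⟪T x, adjoint (A i) y⟫_ℂ := by
      rw [sum_apply, sum_inner]
      refine Finset.sum_congr rfl fun i _ => ?_
      rw [comp_apply, comp_apply, hrank, ← adjoint_inner_right, inner_smul_left, inner_conj_symm]
    rwa [heq] at hpos
  exact hsub (hcyclic ▸ Set.mem_univ v)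
end
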